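/- Let X be a compact Hausdorff topological median algebra of finite rank, and let G be a group acting on X by homeomorphisms that preserve the median, i.e., g·m(x,y,z) = m(g·x, g·y, g·z) for all g ∈ G and x,y,z ∈ X. Then the family 𝓜𝓒 of all continuous median-preserving maps f : X → [0,1] satisfies: (i) 𝓜𝓒 is G-invariant, i.e., for every f ∈ 𝓜𝓒 and g ∈ G the function x ↦ f(g·x) belongs to 𝓜𝓒; (ii) 𝓜𝓒 separates the points of X; (iii) ind(𝓜𝓒) = rank(X) < ∞, and in particular 𝓜𝓒 contains no infinite independent sequence (𝓜𝓒 is a tame family). -/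

import Mathlib

open Set

/-- A median algebra: a ternary operation invariant under permutations of its
arguments, with `m x y y = y` and the standard associativity law. -/
structure MedianStruct (X : Type*) where
  med : X → X → X → X
  med_perm : ∀ (σ : Equiv.Perm (Fin 3)) (v : Fin 3 → X),
    med (v (σ 0)) (v (σ 1)) (v (σ 2)) = med (v 0) (v 1) (v 2)
  med_idem : ∀ x y : X, med x y y = y
  med_assoc : ∀ x y z u w : X,
    med (med x y z) u w = med x (med y u w) (med z u w)

namespace MedianStruct

variable {X : Type*}

/-- The interval `[x,y] = {z | m x y z = z}`. -/
def interval (M : MedianStruct X) (x y : X) : Set X := {z | M.med x y z = z}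

/-- A set is convex if it contains the interval between any two of its points. -/
def IsConvex (M : MedianStruct X) (C : Set X) : Prop :=
  ∀ x ∈ C, ∀ y ∈ C, M.interval x y ⊆ C

/-- A halfspace: a convex set with convex complement. -/
def IsHalfspace (M : MedianStruct X) (H : Set X) : Prop :=
  M.IsConvex H ∧ M.IsConvex Hᶜ

end MedianStruct

/-- Two sets are crossing if all four intersections of them/their complements
are nonempty. -/
def Crossing {X : Type*} (A B : Set X) : Prop :=
  (A ∩ B).Nonempty ∧ (A ∩ Bᶜ).Nonempty ∧ (Aᶜ ∩ B).Nonempty ∧ (Aᶜ ∩ Bᶜ).Nonempty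

/-- A finite family of sets is (Rosenthal) independent. -/
def IndepSetFamily {X : Type*} {k : ℕ} (A : Fin k → Set X) : Prop :=
  ∀ P M : Finset (Fin k), Disjoint P M →
    ((⋂ i ∈ P, A i) ∩ ⋂ j ∈ M, (A j)ᶜ).Nonempty

/-- The independence number of a family of sets: the supremum of the sizes of
independent finite subfamilies. -/
noncomputable def indSets {X : Type*} (𝒞 : Set (Set X)) : ℕ∞ :=
  ⨆ (k : ℕ) (_ : ∃ A : Fin k → Set X,
      (∀ i, A i ∈ 𝒞) ∧ Function.Injective A ∧ IndepSetFamily A), (k : ℕ∞)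

/-- Majority (median) operation on `Bool`. -/
def boolMed (a b c : Bool) : Bool := (a && b) || (b && c) || (a && c)

/-- The coordinatewise majority median on a power of `Bool`. -/
def boolCubeMed (I : Type*) : MedianStruct (I → Bool) where
  med x y z := fun i => boolMed (x i) (y i) (z i)
  med_perm σ v := by
    funext i
    exact (by decide :
      ∀ (τ : Equiv.Perm (Fin 3)) (w : Fin 3 → Bool),
        boolMed (w (τ 0)) (w (τ 1)) (w (τ 2)) = boolMed (w 0) (w 1) (w 2))
      σ (fun j => v j i)
  med_idem x y := by
    funext i
    exact (by decide : ∀ a b : Bool, boolMed a b b = b) (x i) (y i)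
  med_assoc x y z u w := by
    funext i
    exact (by decide : ∀ a b c d e : Bool,
        boolMed (boolMed a b c) d e = boolMed a (boolMed b d e) (boolMed c d e))
      (x i) (y i) (z i) (u i) (w i)

/-- A median-preserving (MP) map between median algebras. -/
def IsMedianHom {X Y : Type*} (M : MedianStruct X) (N : MedianStruct Y)
    (f : X → Y) : Prop :=
  ∀ x y z, f (M.med x y z) = N.med (f x) (f y) (f z)

/-- The rank of a median algebra: the supremum of the `n` such that the Boolean
hypercube `{0,1}ⁿ` embeds into it by an injective median-preserving map. -/
noncomputable def medRank {X : Type*} (M : MedianStruct X) : ℕ∞ :=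
  ⨆ (n : ℕ) (_ : ∃ f : (Fin n → Bool) → X,
      Function.Injective f ∧ IsMedianHom (boolCubeMed (Fin n)) M f), (n : ℕ∞)

/-- The median operation on `ℝ`. -/
noncomputable def realMed (a b c : ℝ) : ℝ := max (max (min a b) (min b c)) (min a c)

/-- A real-valued median-preserving function on a median algebra. -/
def IsMedianPreserving {X : Type*} (M : MedianStruct X) (f : X → ℝ) : Prop :=
  ∀ x y z, f (M.med x y z) = realMed (f x) (f y) (f z)

/-- A finite sequence of real functions is independent with witnessing
constants `a < b`. -/
def IndepFunFinWith {X : Type*} {k : ℕ} (f : Fin k → X → ℝ) (a b : ℝ) : Prop :=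
  ∀ P M : Finset (Fin k), Disjoint P M →
    ((⋂ i ∈ P, {x | f i x ≤ a}) ∩ ⋂ j ∈ M, {x | b ≤ f j x}).Nonempty

/-- A finite sequence of real functions is independent. -/
def IndepFunFin {X : Type*} {k : ℕ} (f : Fin k → X → ℝ) : Prop :=
  ∃ a b : ℝ, a < b ∧ IndepFunFinWith f a b

/-- The independence number of a family of real functions: the supremum of the
lengths of independent finite sequences in the family. -/
noncomputable def indFun {X : Type*} (F : Set (X → ℝ)) : ℕ∞ :=
  ⨆ (k : ℕ) (_ : ∃ f : Fin k → X → ℝ, (∀ i, f i ∈ F) ∧ IndepFunFin f), (k : ℕ∞)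

/-- An infinite sequence of real functions is independent. -/
def IndepFunSeq {X : Type*} (f : ℕ → X → ℝ) : Prop :=
  ∃ a b : ℝ, a < b ∧ ∀ P M : Finset ℕ, Disjoint P M →
    ((⋂ i ∈ P, {x | f i x ≤ a}) ∩ ⋂ j ∈ M, {x | b ≤ f j x}).Nonempty

/-- A finite set `S` is shattered by a family of sets `𝒟`. -/
def Shatters {Y : Type*} (𝒟 : Set (Set Y)) (S : Finset Y) : Prop :=
  ∀ T : Set Y, T ⊆ ↑S → ∃ D ∈ 𝒟, D ∩ ↑S = T

/-- The VC-dimension of a family of sets. -/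
noncomputable def vcDim {Y : Type*} (𝒟 : Set (Set Y)) : ℕ∞ :=
  ⨆ (k : ℕ) (_ : ∃ S : Finset Y, S.card = k ∧ Shatters 𝒟 S), (k : ℕ∞)

/-- The dual set system of `𝒞`: on the ground set `𝒞`, the sets
`R_x = {C ∈ 𝒞 | x ∈ C}` for `x ∈ X`. -/
def dualSystem {X : Type*} (𝒞 : Set (Set X)) : Set (Set ↥𝒞) :=
  {R | ∃ x : X, R = {C : ↥𝒞 | x ∈ (C : Set X)}}

/-- The family of all continuous median-preserving maps `X → [0,1]`. -/
def MCfam {X : Type*} [TopologicalSpace X] (M : MedianStruct X) : Set (X → ℝ) :=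
  {f | Continuous f ∧ IsMedianPreserving M f ∧ ∀ x, f x ∈ Set.Icc (0 : ℝ) 1}

namespace MedianStruct

variable {X : Type*} (M : MedianStruct X)

lemma med_swap_left (x y z : X) : M.med x y z = M.med y x z := by
  simpa [Equiv.swap_apply_def] using M.med_perm (Equiv.swap 0 1) ![y, x, z]

lemma med_swap_right (x y z : X) : M.med x y z = M.med x z y := by
  simpa [Equiv.swap_apply_def] using M.med_perm (Equiv.swap 1 2) ![x, z, y]

lemma med_rotate (x y z : X) : M.med x y z = M.med y z x := by
  rw [M.med_swap_left, M.med_swap_right]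

lemma med_self_left (x y : X) : M.med x x y = x := by
  rw [M.med_rotate, M.med_rotate, M.med_idem]

lemma med_self_mid (x y : X) : M.med x y x = x := by
  rw [M.med_swap_right, M.med_self_left]

lemma med_med_self (x y z : X) : M.med x y (M.med x y z) = M.med x y z := by
  rw [← M.med_rotate, M.med_rotate x y z, M.med_rotate y z x, M.med_assoc, M.med_self_left,
    M.med_self_mid]

variable {M}

lemma IsConvex.med_mem {C : Set X} (hC : M.IsConvex C) {x y : X} (hx : x ∈ C) (hy : y ∈ C)
    (z : X) : M.med x y z ∈ C :=
  hC x hx y hy (M.med_med_self x y z)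

variable (M)

/-- The binary operation `M.med p` is associative. -/
lemma med_base_assoc (p a b c : X) :
    M.med p a (M.med p b c) = M.med p (M.med p a b) c := by
  have h := M.med_assoc a p b p c
  rw [M.med_self_left] at h
  rw [M.med_rotate p a (M.med p b c), M.med_swap_right a, M.med_swap_left p b c, ← h,
    M.med_swap_left p, M.med_swap_left p a b]

lemma med_base_le {p h x k : X} (hk : M.med h x k = k) :
    M.med p k (M.med p h x) = M.med p h x := by
  have hq : M.med (M.med p h x) h x = M.med p h x := by
    rw [M.med_assoc, M.med_self_left, M.med_self_mid]
  have hk' : M.med k h x = k := by rw [M.med_rotate, hk]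
  have h1 := M.med_assoc p k (M.med p h x) h x
  have h2 := M.med_assoc (M.med p h x) p k h x
  rw [hq, hk'] at h1
  rw [hk', M.med_self_left] at h2
  have e := (M.med_rotate (M.med p h x) p k).symm
  rw [e, h2] at h1
  rw [e, ← h1]

/-- The Pasch property of intervals. -/
lemma pasch {x h k h' k' : X} (hk : M.med x h k = k) (hh : M.med x k' h' = h') :
    M.med k k' (M.med h h' k') = M.med h h' k' := by
  have h1 : M.med k' k (M.med k' h x) = M.med k' h x :=
    M.med_base_le (by rw [M.med_swap_left, hk])
  have h2 : M.med k' x h' = h' := by rw [M.med_swap_left, hh]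
  have h3 : M.med h h' k' = M.med k' (M.med k' h x) h' := by
    rw [← M.med_base_assoc, h2, M.med_rotate k']
  rw [h3, M.med_swap_left, M.med_base_assoc, h1]

/-- The union of the intervals from `x` to the points of `C`. -/
def join (x : X) (C : Set X) : Set X := {z | ∃ c ∈ C, M.med x c z = z}

variable {M}

lemma IsConvex.join {C : Set X} (hC : M.IsConvex C) (x : X) : M.IsConvex (M.join x C) := by
  rintro a ⟨c, hc, ha⟩ b ⟨d, hd, hb⟩ z hz
  refine ⟨M.med c d z, hC.med_mem hc hd z, ?_⟩
  have hz : M.med a b z = z := hz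
  have h1 : M.med z a (M.med z x c) = M.med z x c := M.med_base_le ha
  have h2 : M.med z b (M.med z x d) = M.med z x d := M.med_base_le hb
  have hzab : M.med z a b = z := by rw [M.med_rotate, hz]
  have hzz : ∀ w, M.med z z w = z := M.med_self_left z
  have hxx : M.med z x x = x := M.med_idem z x
  have key : M.med z x (M.med z c d) = z := by
    have e1 : M.med z x (M.med z c d) = M.med z (M.med z x c) (M.med z x d) := by
      rw [M.med_base_assoc z (M.med z x c), M.med_swap_right z (M.med z x c) x,
        M.med_base_assoc z x x c, hxx, M.med_base_assoc]
    rw [e1, ← h1, ← h2, ← M.med_base_assoc, M.med_base_assoc z (M.med z x c) b,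
      M.med_swap_right z (M.med z x c) b, ← M.med_base_assoc z b, M.med_base_assoc z a b, hzab,
      hzz]
  rw [← M.med_rotate z c d, ← M.med_rotate z x, key]

lemma subset_join (x : X) (C : Set X) : C ⊆ M.join x C := fun c hc => ⟨c, hc, M.med_idem x c⟩

lemma mem_join {x : X} {C : Set X} (hC : C.Nonempty) : x ∈ M.join x C :=
  let ⟨c, hc⟩ := hC
  ⟨c, hc, M.med_self_mid x c⟩

/-- A convex set can be enlarged, avoiding `B`, until no further point can be joined to it. -/
lemma IsConvex.exists_maximal_disjoint {A B : Set X} (hA : M.IsConvex A) (hne : A.Nonempty)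
    (hAB : Disjoint A B) :
    ∃ H, A ⊆ H ∧ M.IsConvex H ∧ Disjoint H B ∧
      ∀ x ∉ H, ∃ h ∈ H, ∃ b ∈ B, M.med x h b = b := by
  obtain ⟨H, hAH, hmax⟩ := zorn_subset_nonempty {H : Set X | M.IsConvex H ∧ Disjoint H B}
    (by
      intro c hc hchain _
      refine ⟨⋃₀ c, ⟨?_, ?_⟩, fun s hs => subset_sUnion_of_mem hs⟩
      · rintro x ⟨s, hs, hx⟩ y ⟨t, ht, hy⟩ z hz
        rcases hchain.total hs ht with h | h
        · exact ⟨t, ht, (hc ht).1 x (h hx) y hy hz⟩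
        · exact ⟨s, hs, (hc hs).1 x hx y (h hy) hz⟩
      · exact disjoint_sUnion_left.2 fun s hs => (hc hs).2) A ⟨hA, hAB⟩
  refine ⟨H, hAH, hmax.prop.1, hmax.prop.2, fun x hx => ?_⟩
  by_contra! hcon
  have hle := hmax.le_of_ge (y := M.join x H) ⟨hmax.prop.1.join x, ?_⟩ (subset_join x H)
  · exact hx (hle (mem_join (hne.mono hAH)))
  · rw [Set.disjoint_left]
    rintro z ⟨h, hh, hz⟩ hzB
    exact hcon h hh z hzB hz

/-- Disjoint nonempty convex sets are separated by a halfspace. -/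
theorem IsConvex.exists_isHalfspace {A B : Set X} (hA : M.IsConvex A) (hB : M.IsConvex B)
    (hAne : A.Nonempty) (hBne : B.Nonempty) (hAB : Disjoint A B) :
    ∃ H, M.IsHalfspace H ∧ A ⊆ H ∧ B ⊆ Hᶜ := by
  obtain ⟨H, hAH, hH, hHB, hHmax⟩ := hA.exists_maximal_disjoint hAne hAB
  obtain ⟨K, hBK, hK, hKH, hKmax⟩ := hB.exists_maximal_disjoint hBne hHB.symm
  have hcompl : Hᶜ = K := by
    refine Subset.antisymm (fun x hx => ?_) (Set.disjoint_left.1 hKH)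
    by_contra hxK
    obtain ⟨h, hh, b, hb, hhb⟩ := hHmax x hx
    obtain ⟨k, hk, h', hh', hkh⟩ := hKmax x hxK
    refine Set.disjoint_left.1 hKH ?_ (hH.med_mem hh hh' k)
    rw [← M.pasch hhb hkh]
    exact hK.med_mem (hBK hb) hk _
  exact ⟨H, ⟨hH, hcompl ▸ hK⟩, hAH, hcompl ▸ hBK⟩

variable (M) in
/-- A median homomorphism to `Bool`. -/
def IsBoolHom (φ : X → Bool) : Prop :=
  ∀ x y z, φ (M.med x y z) = boolMed (φ x) (φ y) (φ z)

lemma IsBoolHom.isConvex {φ : X → Bool} (hφ : M.IsBoolHom φ) (b : Bool) :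
    M.IsConvex {x | φ x = b} := by
  intro x hx y hy z hz
  have h := hφ x y z
  rw [show M.med x y z = z from hz, show φ x = b from hx, show φ y = b from hy] at h
  change φ z = b
  rw [h]
  cases b <;> cases φ z <;> rfl

lemma isConvex_singleton (x : X) : M.IsConvex {x} := by
  rintro a rfl b rfl z hz
  have hz : M.med b b z = z := hz
  rw [M.med_self_left] at hz
  exact hz.symm

open Classical in
lemma IsHalfspace.isBoolHom {H : Set X} (hH : M.IsHalfspace H) :
    M.IsBoolHom fun x => decide (x ∈ H) := by
  intro x y z
  have h1 : ∀ {a b : X} (c : X), a ∈ H → b ∈ H → M.med a b c ∈ H :=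
    fun c ha hb => hH.1.med_mem ha hb c
  have h2 : ∀ {a b : X} (c : X), a ∉ H → b ∉ H → M.med a b c ∉ H :=
    fun c ha hb => hH.2.med_mem (C := Hᶜ) ha hb c
  have r1 := M.med_rotate x y z
  have r2 : M.med x y z = M.med x z y := M.med_swap_right x y z
  by_cases hx : x ∈ H <;> by_cases hy : y ∈ H <;> by_cases hz : z ∈ H <;>
    simp only [hx, hy, hz, boolMed, decide_true, decide_false, Bool.and_true, Bool.and_false,
      Bool.or_true, Bool.or_false, decide_eq_true_eq, decide_eq_false_iff_not]
  · exact h1 _ hx hy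
  · exact h1 _ hx hy
  · exact r2 ▸ h1 _ hx hz
  · exact r1 ▸ h2 _ hy hz
  · exact r1 ▸ h1 _ hy hz
  · exact r2 ▸ h2 _ hx hz
  · exact h2 _ hx hy
  · exact h2 _ hx hy

theorem IsConvex.exists_isBoolHom {A B : Set X} (hA : M.IsConvex A) (hB : M.IsConvex B)
    (hAne : A.Nonempty) (hBne : B.Nonempty) (hAB : Disjoint A B) :
    ∃ φ, M.IsBoolHom φ ∧ (∀ a ∈ A, φ a = true) ∧ ∀ b ∈ B, φ b = false := by
  classical
  obtain ⟨H, hH, hAH, hBH⟩ := hA.exists_isHalfspace hB hAne hBne hAB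
  exact ⟨_, hH.isBoolHom, fun a ha => decide_eq_true (hAH ha),
    fun b hb => decide_eq_false (hBH hb)⟩

/-- Homomorphisms to `Bool` separate points. -/
theorem eq_of_forall_isBoolHom {a b : X} (h : ∀ φ, M.IsBoolHom φ → φ a = φ b) : a = b := by
  by_contra hab
  obtain ⟨φ, hφ, ha, hb⟩ := (isConvex_singleton (M := M) a).exists_isBoolHom
    (isConvex_singleton b) (singleton_nonempty a) (singleton_nonempty b) (by simpa using hab)
  simpa [ha a rfl, hb b rfl] using h φ hφ

variable (M)

/-- Membership in the convex hull, generated by taking intervals. -/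
inductive InHull (A : Set X) : X → Prop
  | of_mem {x : X} : x ∈ A → InHull A x
  | of_interval {a b z : X} : InHull A a → InHull A b → M.med a b z = z → InHull A z

/-- The convex hull of a set. -/
def hull (A : Set X) : Set X := {x | M.InHull A x}

variable {M}

lemma subset_hull (A : Set X) : A ⊆ M.hull A := fun _ => InHull.of_mem

lemma isConvex_hull (A : Set X) : M.IsConvex (M.hull A) :=
  fun _ ha _ hb _ hz => InHull.of_interval ha hb hz

lemma hull_subset {A C : Set X} (hC : M.IsConvex C) (hAC : A ⊆ C) : M.hull A ⊆ C := by
  intro x hx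
  induction hx with
  | of_mem h => exact hAC h
  | of_interval _ _ h iha ihb => exact hC _ iha _ ihb h

lemma hull_mono {A B : Set X} (h : A ⊆ B) : M.hull A ⊆ M.hull B :=
  hull_subset (isConvex_hull B) (h.trans (subset_hull B))

lemma exists_finset_mem_hull {A : Set X} {x : X} (hx : x ∈ M.hull A) :
    ∃ F : Finset X, ↑F ⊆ A ∧ x ∈ M.hull (F : Set X) := by
  classical
  induction hx with
  | @of_mem x h => exact ⟨{x}, by simpa using h, subset_hull _ (by simp)⟩
  | of_interval _ _ h iha ihb =>
    obtain ⟨F, hF, ha⟩ := iha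
    obtain ⟨G, hG, hb⟩ := ihb
    exact ⟨F ∪ G, by simp [hF, hG],
      isConvex_hull _ _ (hull_mono (by simp) ha) _ (hull_mono (by simp) hb) h⟩

lemma hull_insert_subset (a : X) {F : Set X} (hF : F.Nonempty) :
    M.hull (insert a F) ⊆ M.join a (M.hull F) :=
  hull_subset ((isConvex_hull F).join a) (insert_subset
    (mem_join (hF.mono (subset_hull F))) ((subset_hull F).trans (subset_join a _)))

variable (M) in
/-- `π` is a gate map onto `C`: it sends `x` to the point of `C` between `x` and all of `C`. -/
structure IsGateMap (C : Set X) (π : X → X) : Prop where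
  mem : ∀ x, π x ∈ C
  med_eq : ∀ x, ∀ c ∈ C, M.med x c (π x) = π x

lemma IsGateMap.apply_of_mem {C : Set X} {π : X → X} (hπ : M.IsGateMap C π) {c : X} (hc : c ∈ C) :
    π c = c := by
  rw [← hπ.med_eq c c hc, M.med_self_left]

lemma IsGateMap.map_med {C : Set X} {π : X → X} (hC : M.IsConvex C) (hπ : M.IsGateMap C π)
    (x y z : X) : π (M.med x y z) = M.med (π x) (π y) (π z) := by
  have hmem : M.med (π x) (π y) (π z) ∈ C := hC.med_mem (hπ.mem x) (hπ.mem y) _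
  have h1 := hπ.med_eq (M.med x y z) _ hmem
  have key : ∀ c ∈ C, M.med (M.med x y z) c (M.med (π x) (π y) (π z)) =
      M.med (π x) (π y) (π z) := by
    intro c hc
    refine eq_of_forall_isBoolHom (M := M) fun φ hφ => ?_
    have hx := congrArg φ (hπ.med_eq x c hc)
    have hy := congrArg φ (hπ.med_eq y c hc)
    have hz := congrArg φ (hπ.med_eq z c hc)
    simp only [hφ _ _ _] at hx hy hz ⊢
    revert hx hy hz
    generalize φ x = x, φ y = y, φ z = z, φ c = c, φ (π x) = x', φ (π y) = y', φ (π z) = z'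
    revert x y z c x' y' z'
    decide
  rw [← h1, M.med_swap_right]
  exact key _ (hπ.mem _)

lemma exists_gate_hull (F : Finset X) (hF : F.Nonempty) (x : X) :
    ∃ g ∈ M.hull (F : Set X), ∀ c ∈ M.hull (F : Set X), M.med x c g = g := by
  classical
  have hconv : ∀ g, M.IsConvex {c | M.med x c g = g} := by
    intro g a ha b hb z hz
    refine eq_of_forall_isBoolHom (M := M) fun φ hφ => ?_
    have ha := congrArg φ (show M.med x a g = g from ha)
    have hb := congrArg φ (show M.med x b g = g from hb)
    have hz := congrArg φ (show M.med a b z = z from hz)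
    simp only [hφ _ _ _] at ha hb hz ⊢
    revert ha hb hz
    generalize φ x = x, φ a = a, φ b = b, φ z = z, φ g = g
    revert x a b z g
    decide
  suffices h : ∃ g ∈ M.hull (F : Set X), ∀ c ∈ F, M.med x c g = g by
    obtain ⟨g, hg, h⟩ := h
    exact ⟨g, hg, hull_subset (hconv g) h⟩
  induction hF using Finset.Nonempty.cons_induction with
  | singleton a => exact ⟨a, subset_hull _ (by simp), by simp [M.med_idem]⟩
  | cons a s has hs ih =>
    obtain ⟨g, hg, h⟩ := ih
    refine ⟨M.med a g x, (isConvex_hull _).med_mem (subset_hull _ (by simp))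
      (hull_mono (by simp) hg) x, fun c hc => ?_⟩
    refine eq_of_forall_isBoolHom (M := M) fun φ hφ => ?_
    rcases Finset.mem_cons.1 hc with rfl | hc
    · simp only [hφ _ _ _]
      generalize φ x = x, φ c = c, φ g = g
      revert x c g
      decide
    · have h := congrArg φ (h c hc)
      simp only [hφ _ _ _] at h ⊢
      revert h
      generalize φ x = x, φ c = c, φ g = g, φ a = a
      revert x c g a
      decide

lemma exists_isGateMap_hull {F : Set X} (hfin : F.Finite) (hF : F.Nonempty) :
    ∃ π, M.IsGateMap (M.hull F) π := by
  lift F to Finset X using hfin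
  choose π hπ using M.exists_gate_hull F hF
  exact ⟨π, fun x => (hπ x).1, fun x => (hπ x).2⟩

/-- If all corners of a family of pairs of convex sets are nonempty, there is a cube with one
vertex in each corner. -/
theorem exists_cube_of_corners (k : ℕ) (S : Fin k → Bool → Set X)
    (hS : ∀ i b, M.IsConvex (S i b)) (Y : Set X) (hY : M.IsConvex Y)
    (hcorner : ∀ ε : Fin k → Bool, ∃ x ∈ Y, ∀ i, x ∈ S i (ε i)) :
    ∃ f : (Fin k → Bool) → X, IsMedianHom (boolCubeMed (Fin k)) M f ∧
      ∀ ε, f ε ∈ Y ∧ ∀ i, f ε ∈ S i (ε i) := by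
  induction k generalizing Y with
  | zero =>
    obtain ⟨x, hx, -⟩ := hcorner finZeroElim
    exact ⟨fun _ => x, fun _ _ _ => (M.med_idem x x).symm, fun _ => ⟨hx, finZeroElim⟩⟩
  | succ k ih =>
    choose x hxY hxS using hcorner
    let C : Bool → Set X := fun b => M.hull (range fun ε : Fin k → Bool => x (Fin.cons b ε))
    have hC : ∀ b, M.IsConvex (C b) := fun b => isConvex_hull _
    have hxC : ∀ b ε, x (Fin.cons b ε) ∈ C b := fun b ε => subset_hull _ ⟨ε, rfl⟩
    have hCY : ∀ b, C b ⊆ Y := fun b => hull_subset hY (by rintro _ ⟨ε, rfl⟩; exact hxY _)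
    have hCS : ∀ b, C b ⊆ S 0 b := fun b => hull_subset (hS 0 b) (by
      rintro _ ⟨ε, rfl⟩
      simpa using hxS (Fin.cons b ε) 0)
    have hxtail : ∀ b ε i, x (Fin.cons b ε) ∈ S (Fin.succ i) (ε i) := fun b ε i => by
      simpa using hxS (Fin.cons b ε) i.succ
    have hgate : ∀ b, ∃ π, M.IsGateMap (C b) π := fun b =>
      exists_isGateMap_hull (finite_range _) (range_nonempty _)
    choose π hπ using hgate
    have hmap := fun b => (hπ b).map_med (hC b)
    let Z : Set X := {a | a ∈ C false ∧ π false (π true a) = a}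
    have hZ : M.IsConvex Z := by
      rintro a ⟨ha, ha'⟩ c ⟨hc, hc'⟩ z hz
      have hz : M.med a c z = z := hz
      refine ⟨hC _ a ha c hc hz, ?_⟩
      have h1 : π true z = M.med (π true a) (π true c) z := by
        rw [← (hπ true).apply_of_mem ((hC true).med_mem ((hπ true).mem a) ((hπ true).mem c) z),
          hmap, (hπ true).apply_of_mem ((hπ true).mem a), (hπ true).apply_of_mem ((hπ true).mem c),
          ← hmap, hz]
      rw [h1, hmap, ha', hc', (hπ false).apply_of_mem (hC _ a ha c hc hz), hz]
    obtain ⟨f, hf, hfS⟩ := ih (fun i => S i.succ) (fun i => hS i.succ) Z hZ (fun ε => by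
      refine ⟨π false (x (Fin.cons true ε)), ⟨(hπ false).mem _, ?_⟩, fun i => ?_⟩
      · have h1 := (hπ true).med_eq (π false (x (Fin.cons true ε))) _ (hxC true ε)
        rw [← h1, hmap, (hπ false).apply_of_mem ((hπ false).mem _), M.med_self_left]
      · exact hS _ _ _ (hxtail true ε i) _ (hxtail false ε i)
          ((hπ false).med_eq _ _ (hxC false ε)))
    refine ⟨fun ε => if ε 0 then π true (f (Fin.tail ε)) else f (Fin.tail ε), ?_, ?_⟩
    · intro u v w
      have htail : Fin.tail ((boolCubeMed (Fin (k + 1))).med u v w) =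
          (boolCubeMed (Fin k)).med (Fin.tail u) (Fin.tail v) (Fin.tail w) := rfl
      have hhead : (boolCubeMed (Fin (k + 1))).med u v w 0 = boolMed (u 0) (v 0) (w 0) := rfl
      simp only [htail, hhead, hf _ _ _]
      have hF := fun ε => (hfS ε).1.1
      have hR := fun ε => (hfS ε).1.2
      generalize Fin.tail u = u', Fin.tail v = v', Fin.tail w = w'
      have hff : ∀ a b c, M.med (f a) (f b) (π true (f c)) = M.med (f a) (f b) (f c) := by
        intro a b c
        rw [← (hπ false).apply_of_mem ((hC false).med_mem (hF a) (hF b) _), hmap, hR,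
          (hπ false).apply_of_mem (hF a), (hπ false).apply_of_mem (hF b)]
      have htt : ∀ a b c, M.med (π true (f a)) (π true (f b)) (f c) =
          π true (M.med (f a) (f b) (f c)) := by
        intro a b c
        rw [← (hπ true).apply_of_mem
          ((hC true).med_mem ((hπ true).mem (f a)) ((hπ true).mem (f b)) _), hmap, hmap,
          (hπ true).apply_of_mem ((hπ true).mem _), (hπ true).apply_of_mem ((hπ true).mem _)]
      cases u 0 <;> cases v 0 <;> cases w 0 <;> simp only [boolMed, Bool.and_true, Bool.and_false,
        Bool.or_true, Bool.or_false, Bool.false_eq_true, if_true, if_false, hff, htt, hmap]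
      · rw [M.med_swap_right (f u') (π true (f v')), hff, M.med_swap_right]
      · rw [← hmap, M.med_rotate (f u') (π true (f v')), htt, M.med_rotate (f u')]
      · rw [M.med_rotate, M.med_rotate (π true (f u')), hff]
      · rw [← hmap, M.med_swap_right (π true (f u')) (f v'), htt, M.med_swap_right (f u')]
    · intro ε
      by_cases h0 : ε 0
      · simp only [h0, if_true]
        refine ⟨hCY _ ((hπ true).mem _), Fin.cases ?_ fun i => ?_⟩
        · rw [h0]
          exact hCS _ ((hπ true).mem _)
        · exact hS _ _ _ ((hfS (Fin.tail ε)).2 i) _ (hxtail true (Fin.tail ε) i)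
            ((hπ true).med_eq _ _ (hxC true _))
      · simp only [h0]
        refine ⟨hCY _ (hfS _).1.1, Fin.cases ?_ fun i => (hfS (Fin.tail ε)).2 i⟩
        rw [Bool.not_eq_true] at h0
        rw [h0]
        exact hCS _ (hfS _).1.1

theorem le_medRank_of_corners {k : ℕ} (S : Fin k → Bool → Set X)
    (hS : ∀ i b, M.IsConvex (S i b)) (hdisj : ∀ i, Disjoint (S i true) (S i false))
    (hcorner : ∀ ε : Fin k → Bool, ∃ x, ∀ i, x ∈ S i (ε i)) : (k : ℕ∞) ≤ medRank M := by
  obtain ⟨f, hf, hfS⟩ := exists_cube_of_corners k S hS univ (fun _ _ _ _ _ _ => trivial)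
    (fun ε => (hcorner ε).imp fun _ h => ⟨trivial, h⟩)
  refine le_iSup₂_of_le k ⟨f, fun ε δ h => funext fun i => ?_, hf⟩ le_rfl
  have h1 := (hfS ε).2 i
  have h2 := (hfS δ).2 i
  rw [h] at h1
  have := Set.disjoint_left.1 (hdisj i)
  cases hε : ε i <;> cases hδ : δ i <;> simp_all

/-- A bound for the Carathéodory number in terms of the rank. -/
theorem exists_finset_card_le_mem_hull {n : ℕ} (hn : medRank M ≤ n) (F : Finset X) {x : X}
    (hx : x ∈ M.hull (F : Set X)) :
    ∃ G ⊆ F, G.card ≤ max n 2 ∧ x ∈ M.hull (G : Set X) := by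
  classical
  induction F using Finset.strongInduction with
  | H F ih =>
    by_cases hcard : F.card ≤ max n 2
    · exact ⟨F, Finset.Subset.refl F, hcard, hx⟩
    by_cases hex : ∃ a ∈ F, x ∈ M.hull (F.erase a : Set X)
    · obtain ⟨a, ha, hxa⟩ := hex
      obtain ⟨G, hG, h⟩ := ih _ (Finset.erase_ssubset ha) (by simpa using hxa)
      exact ⟨G, hG.trans (Finset.erase_subset a F), h⟩
    exfalso
    push Not at hex hcard
    rw [max_lt_iff] at hcard
    have hφ : ∀ a : F, ∃ φ, M.IsBoolHom φ ∧ φ x = true ∧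
        ∀ b ∈ M.hull (F.erase a.1 : Set X), φ b = false := by
      intro a
      obtain ⟨φ, h, h1, h2⟩ := (isConvex_singleton (M := M) x).exists_isBoolHom
        (isConvex_hull (F.erase a.1 : Set X)) (singleton_nonempty x) (by
          have : (F.erase a.1).Nonempty := by
            rw [← Finset.card_pos, Finset.card_erase_of_mem a.2]
            omega
          obtain ⟨b, hb⟩ := this
          exact ⟨b, subset_hull _ (Finset.mem_coe.2 hb)⟩)
        (by simpa using hex a.1 a.2)
      exact ⟨φ, h, h1 x rfl, h2⟩
    choose φ hhom hφx hφF using hφ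
    have hne : ∀ a : F, ∀ b ∈ F, b ≠ a → φ a b = false := fun a b hb hba =>
      hφF a b (subset_hull _ (by simp [hb, hba]))
    have hself : ∀ a : F, φ a a = true := by
      intro a
      by_contra h
      have := hull_subset ((hhom a).isConvex false) (fun b hb => by
        by_cases hba : b = a
        · simpa [hba] using h
        · exact hne a b hb hba) hx
      simp [hφx] at this
    have e := F.equivFin
    have hle := le_medRank_of_corners (M := M)
      (fun (i : Fin F.card) b => {y | φ (e.symm i) y = b}) (fun i b => (hhom _).isConvex b)
      (fun i => Set.disjoint_left.2 fun y h1 h2 => by simp_all) (fun ε => by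
        by_cases hε : ∃ a : F, ε (e a) = true
        · obtain ⟨a₀, ha₀⟩ := hε
          let G : Finset X := (Finset.univ.filter fun a : F => ε (e a) = true).map
            (Function.Embedding.subtype _)
          have hG : ∀ a : F, a.1 ∈ G ↔ ε (e a) = true := fun a => by simp [G]
          have hGF : G ⊆ F := fun a ha => by
            simp only [G, Finset.mem_map] at ha
            obtain ⟨b, -, rfl⟩ := ha
            exact b.2
          obtain ⟨g, hg, hgc⟩ := M.exists_gate_hull G ⟨a₀, (hG a₀).2 ha₀⟩ x
          refine ⟨g, fun i => ?_⟩
          obtain ⟨a, rfl⟩ := e.surjective i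
          simp only [Equiv.symm_apply_apply, mem_ofPred_eq]
          cases hεa : ε (e a)
          · refine hφF a g (hull_mono (fun b hb => ?_) hg)
            have : b ≠ a := by
              rintro rfl
              have := (hG a).1 hb
              simp_all
            simpa [this] using hGF hb
          · have h := congrArg (φ a) (hgc a (subset_hull _ ((hG a).2 hεa)))
            rw [hhom, hφx, hself] at h
            rw [← h]
            cases φ a g <;> rfl
        · push Not at hε
          obtain ⟨a, ha, b, hb, c, hc, hab, hac, hbc⟩ := Finset.two_lt_card.1 hcard.2
          refine ⟨M.med a b c, fun i => ?_⟩
          obtain ⟨d, rfl⟩ := e.surjective i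
          have hd := hε d
          rw [ne_eq, Bool.not_eq_true] at hd
          simp only [Equiv.symm_apply_apply, mem_ofPred_eq, hd, (hhom d) _ _ _]
          by_cases h1 : a = d
          · rw [hne d b hb (by rw [← h1]; exact hab.symm),
              hne d c hc (by rw [← h1]; exact hac.symm)]
            cases φ d a <;> rfl
          · rw [hne d a ha h1]
            by_cases h2 : b = d
            · rw [hne d c hc (by rw [← h2]; exact hbc.symm)]
              cases φ d b <;> rfl
            · rw [hne d b hb h2]
              cases φ d c <;> rfl)
    have := hle.trans hn
    rw [Nat.cast_le] at this
    omega

variable (M) in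
/-- Iterated joins of a set with itself. -/
def iterJoin (A : Set X) : ℕ → Set X
  | 0 => A
  | n + 1 => {z | ∃ a ∈ A, ∃ b ∈ iterJoin A n, M.med a b z = z}

lemma iterJoin_mono {A B : Set X} (h : A ⊆ B) (n : ℕ) : M.iterJoin A n ⊆ M.iterJoin B n := by
  induction n with
  | zero => exact h
  | succ n ih =>
    rintro z ⟨a, ha, b, hb, hz⟩
    exact ⟨a, h ha, b, ih hb, hz⟩

lemma subset_iterJoin (A : Set X) (n : ℕ) : A ⊆ M.iterJoin A n := by
  induction n with
  | zero => exact Subset.rfl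
  | succ n ih => exact fun a ha => ⟨a, ha, a, ih ha, M.med_idem a a⟩

lemma hull_finset_subset_iterJoin {A : Set X} (n : ℕ) (F : Finset X) (hFA : ↑F ⊆ A)
    (hcard : F.card ≤ n + 1) : M.hull (F : Set X) ⊆ M.iterJoin A n := by
  classical
  induction F using Finset.induction_on generalizing n with
  | empty =>
    exact (hull_subset (C := ∅) (fun _ h => h.elim) (by simp)).trans (empty_subset _)
  | insert a F ha ih =>
    rw [Finset.card_insert_of_notMem ha] at hcard
    rw [Finset.coe_insert, insert_subset_iff] at hFA
    rcases F.eq_empty_or_nonempty with rfl | hF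
    · refine (hull_subset (isConvex_singleton a) (by simp)).trans ?_
      exact singleton_subset_iff.2 (subset_iterJoin A n hFA.1)
    · obtain ⟨n, rfl⟩ : ∃ m, n = m + 1 :=
        ⟨n - 1, by have := hF.card_pos; omega⟩
      intro z hz
      rw [Finset.coe_insert] at hz
      obtain ⟨y, hy, hyz⟩ := hull_insert_subset a (by simpa using hF) hz
      exact ⟨a, hFA.1, y, ih n hFA.2 (by omega) hy, hyz⟩

/-- In finite rank, convex hulls are obtained after boundedly many joins. -/
theorem hull_subset_iterJoin {n : ℕ} (hn : medRank M ≤ n) (A : Set X) :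
    M.hull A ⊆ M.iterJoin A (max n 2) := by
  intro x hx
  obtain ⟨F, hFA, hxF⟩ := exists_finset_mem_hull hx
  obtain ⟨G, hGF, hG, hxG⟩ := exists_finset_card_le_mem_hull hn F hxF
  exact hull_finset_subset_iterJoin _ G (fun a ha => hFA (hGF ha)) (by omega) hxG

end MedianStruct

namespace MedianStruct

variable {X : Type*} {M : MedianStruct X} [TopologicalSpace X]

lemma isConvex_closure (hm : Continuous fun p : X × X × X => M.med p.1 p.2.1 p.2.2) {C : Set X}
    (hC : M.IsConvex C) : M.IsConvex (closure C) := by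
  intro x hx y hy z hz
  have h : (x, y) ∈ closure (C ×ˢ C) := by
    rw [closure_prod_eq]
    exact ⟨hx, hy⟩
  have hmaps : MapsTo (fun p : X × X => M.med p.1 p.2 z) (C ×ˢ C) C :=
    fun p hp => hC.med_mem hp.1 hp.2 z
  have hcont : Continuous fun p : X × X => M.med p.1 p.2 z :=
    hm.comp (by fun_prop : Continuous fun p : X × X => (p.1, p.2, z))
  have hmem : M.med x y z ∈ closure C := hmaps.closure hcont h
  rwa [show M.med x y z = z from hz] at hmem

variable [CompactSpace X]

lemma exists_isOpen_iterJoin_subset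
    (hm : Continuous fun p : X × X × X => M.med p.1 p.2.1 p.2.2) {A : Set X} (hA : IsClosed A) (hconv : M.IsConvex A) (n : ℕ)
    {U : Set X} (hU : IsOpen U) (hAU : A ⊆ U) :
    ∃ V, IsOpen V ∧ A ⊆ V ∧ M.iterJoin V n ⊆ U := by
  induction n generalizing U with
  | zero => exact ⟨U, hU, hAU, Subset.rfl⟩
  | succ n ih =>
    obtain ⟨V₁, T, hV₁, hT, hAV₁, hAT, hV₁T⟩ := generalized_tube_lemma hA.isCompact
      (hA.isCompact.prod isCompact_univ) (hU.preimage hm)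
      (fun p hp => hAU (hconv.med_mem hp.1 hp.2.1 p.2.2))
    obtain ⟨V₂, Q, hV₂, -, hAV₂, hQ, hV₂Q⟩ := generalized_tube_lemma hA.isCompact
      isCompact_univ hT hAT
    obtain ⟨W, hW, hAW, hWV⟩ := ih hV₂ hAV₂
    refine ⟨V₁ ∩ W, hV₁.inter hW, subset_inter hAV₁ hAW, ?_⟩
    rintro z ⟨a, ha, b, hb, hz⟩
    rw [← hz]
    have hbV : b ∈ V₂ := hWV (iterJoin_mono inter_subset_right n hb)
    exact hV₁T (a := (a, b, z)) ⟨ha.1, hV₂Q (a := (b, z)) ⟨hbV, hQ trivial⟩⟩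

/-- In finite rank, closed convex sets have convex hulls of neighborhoods in every neighborhood. -/
lemma exists_isOpen_hull_subset
    (hm : Continuous fun p : X × X × X => M.med p.1 p.2.1 p.2.2) {n : ℕ} (hn : medRank M ≤ n) {A : Set X} (hA : IsClosed A)
    (hconv : M.IsConvex A) {U : Set X} (hU : IsOpen U) (hAU : A ⊆ U) :
    ∃ V, IsOpen V ∧ A ⊆ V ∧ M.hull V ⊆ U := by
  obtain ⟨V, hV, hAV, hVU⟩ := exists_isOpen_iterJoin_subset hm hA hconv (max n 2) hU hAU
  exact ⟨V, hV, hAV, (hull_subset_iterJoin hn V).trans hVU⟩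

variable [T2Space X]

/-- Disjoint closed convex sets are contained in the interiors of complementary halfspaces. -/
theorem exists_isHalfspace_interior
    (hm : Continuous fun p : X × X × X => M.med p.1 p.2.1 p.2.2) {n : ℕ} (hn : medRank M ≤ n) {A B : Set X}
    (hA : IsClosed A) (hAc : M.IsConvex A) (hAne : A.Nonempty)
    (hB : IsClosed B) (hBc : M.IsConvex B) (hBne : B.Nonempty) (hAB : Disjoint A B) :
    ∃ H, M.IsHalfspace H ∧ A ⊆ interior H ∧ B ⊆ interior Hᶜ := by
  obtain ⟨U, W, hU, hW, hAU, hBW, hUW⟩ := normal_separation hA hB hAB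
  obtain ⟨V, hV, hAV, hVU⟩ := exists_isOpen_hull_subset hm hn hA hAc hU hAU
  obtain ⟨V', hV', hBV', hVW⟩ := exists_isOpen_hull_subset hm hn hB hBc hW hBW
  obtain ⟨H, hH, h1, h2⟩ := (isConvex_hull (M := M) V).exists_isHalfspace (isConvex_hull V')
    (hAne.mono (hAV.trans (subset_hull V))) (hBne.mono (hBV'.trans (subset_hull V')))
    (hUW.mono hVU hVW)
  exact ⟨H, hH, hAV.trans (interior_maximal ((subset_hull V).trans h1) hV),
    hBV'.trans (interior_maximal ((subset_hull V').trans h2) hV')⟩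

end MedianStruct

lemma Monotone.map_realMed {g : ℝ → ℝ} (hg : Monotone g) (a b c : ℝ) :
    g (realMed a b c) = realMed (g a) (g b) (g c) := by
  simp only [realMed, hg.map_max, hg.map_min]

/-- A family of pairs of sets, each separated by a set whose closure and whose complement's closure
give two further pairs of the family. -/
structure BisectionSystem (X P : Type*) [TopologicalSpace X] where
  left : P → Set X
  right : P → Set X
  half : P → Set X
  fst : P → P
  snd : P → P
  left_fst : ∀ p, left (fst p) = left p
  right_fst : ∀ p, right (fst p) = closure (half p)ᶜ
  left_snd : ∀ p, left (snd p) = closure (half p)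
  right_snd : ∀ p, right (snd p) = right p
  left_subset : ∀ p, left p ⊆ half p
  right_subset : ∀ p, right p ⊆ (half p)ᶜ

namespace BisectionSystem

open Filter Topology

variable {X P : Type*} [TopologicalSpace X] (B : BisectionSystem X P)

open Classical in
/-- Approximations of a Urysohn function. -/
noncomputable def approx : ℕ → P → X → ℝ
  | 0, p, x => if x ∈ B.half p then 0 else 1
  | n + 1, p, x => (approx n (B.fst p) x + approx n (B.snd p) x) / 2

lemma approx_succ (n : ℕ) (p : P) (x : X) :
    B.approx (n + 1) p x = (B.approx n (B.fst p) x + B.approx n (B.snd p) x) / 2 := rfl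

lemma approx_mem_Icc (n : ℕ) (p : P) (x : X) : B.approx n p x ∈ Icc (0 : ℝ) 1 := by
  induction n generalizing p with
  | zero => unfold approx; split_ifs <;> simp
  | succ n ih =>
    have h1 := ih (B.fst p)
    have h2 := ih (B.snd p)
    rw [approx_succ]
    constructor <;> linarith [h1.1, h1.2, h2.1, h2.2]

lemma approx_of_mem_left (n : ℕ) {p : P} {x : X} (hx : x ∈ B.left p) : B.approx n p x = 0 := by
  induction n generalizing p with
  | zero => simp [approx, B.left_subset p hx]
  | succ n ih =>
    rw [approx_succ, ih (by rwa [B.left_fst]),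
      ih (by rw [B.left_snd]; exact subset_closure (B.left_subset p hx))]
    norm_num

lemma approx_of_mem_right (n : ℕ) {p : P} {x : X} (hx : x ∈ B.right p) : B.approx n p x = 1 := by
  induction n generalizing p with
  | zero => simp [approx, show x ∉ B.half p from B.right_subset p hx]
  | succ n ih =>
    rw [approx_succ, ih (p := B.snd p) (by rwa [B.right_snd]),
      ih (by rw [B.right_fst]; exact subset_closure (B.right_subset p hx))]
    norm_num

lemma approx_snd_of_mem (n : ℕ) {p : P} {x : X} (hx : x ∈ closure (B.half p)) :
    B.approx n (B.snd p) x = 0 :=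
  B.approx_of_mem_left n (by rwa [B.left_snd])

lemma approx_fst_of_mem (n : ℕ) {p : P} {x : X} (hx : x ∈ closure (B.half p)ᶜ) :
    B.approx n (B.fst p) x = 1 :=
  B.approx_of_mem_right n (by rwa [B.right_fst])

lemma dist_approx_succ (n : ℕ) (p : P) (x : X) :
    dist (B.approx n p x) (B.approx (n + 1) p x) ≤ 1 / 2 / 2 ^ n := by
  rw [Real.dist_eq]
  induction n generalizing p with
  | zero =>
    rw [approx_succ]
    by_cases hx : x ∈ B.half p
    · rw [B.approx_snd_of_mem 0 (subset_closure hx), show B.approx 0 p x = 0 by simp [approx, hx],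
        abs_le]
      have := B.approx_mem_Icc 0 (B.fst p) x
      constructor <;> norm_num <;> linarith [this.1, this.2]
    · rw [B.approx_fst_of_mem 0 (subset_closure hx), show B.approx 0 p x = 1 by simp [approx, hx],
        abs_le]
      have := B.approx_mem_Icc 0 (B.snd p) x
      constructor <;> norm_num <;> linarith [this.1, this.2]
  | succ n ih =>
    rw [B.approx_succ (n + 1), B.approx_succ n p]
    have e : (1 : ℝ) / 2 / 2 ^ (n + 1) = (1 / 2 / 2 ^ n) / 2 := by rw [pow_succ]; ring
    rw [e]
    by_cases hx : x ∈ B.half p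
    · rw [B.approx_snd_of_mem _ (subset_closure hx), B.approx_snd_of_mem _ (subset_closure hx)]
      have := abs_le.1 (ih (B.fst p))
      rw [abs_le]
      constructor <;> linarith [this.1, this.2]
    · rw [B.approx_fst_of_mem _ (subset_closure hx), B.approx_fst_of_mem _ (subset_closure hx)]
      have := abs_le.1 (ih (B.snd p))
      rw [abs_le]
      constructor <;> linarith [this.1, this.2]

lemma eventually_abs_approx_sub_le (n : ℕ) (p : P) (x : X) :
    ∀ᶠ y in 𝓝 x, |B.approx n p y - B.approx n p x| ≤ 1 / 2 ^ n := by
  induction n generalizing p with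
  | zero =>
    refine Eventually.of_forall fun y => ?_
    have hx := B.approx_mem_Icc 0 p x
    have hy := B.approx_mem_Icc 0 p y
    rw [abs_le]
    constructor <;> norm_num <;> linarith [hx.1, hx.2, hy.1, hy.2]
  | succ n ih =>
    have e : (1 : ℝ) / 2 ^ (n + 1) = (1 / 2 ^ n) / 2 := by rw [pow_succ]; ring
    simp only [approx_succ, e]
    by_cases h1 : x ∈ closure (B.half p)ᶜ
    · by_cases h2 : x ∈ closure (B.half p)
      · filter_upwards [ih (B.fst p), ih (B.snd p)] with y hy1 hy2
        rw [B.approx_snd_of_mem n h2, B.approx_fst_of_mem n h1, abs_le] at *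
        by_cases hy : y ∈ B.half p
        · rw [B.approx_snd_of_mem n (subset_closure hy)]
          constructor <;> linarith [hy1.1, hy1.2]
        · rw [B.approx_fst_of_mem n (subset_closure hy)]
          constructor <;> linarith [hy2.1, hy2.2]
      · filter_upwards [ih (B.snd p), isClosed_closure.isOpen_compl.mem_nhds h2] with y hy hyH
        rw [B.approx_fst_of_mem n h1,
          B.approx_fst_of_mem n (subset_closure fun h => hyH (subset_closure h)), abs_le] at *
        constructor <;> linarith [hy.1, hy.2]
    · have h2 : x ∈ closure (B.half p) := subset_closure
        (by_contra fun h => h1 (subset_closure h))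
      filter_upwards [ih (B.fst p), isClosed_closure.isOpen_compl.mem_nhds h1] with y hy hyH
      rw [B.approx_snd_of_mem n h2,
        B.approx_snd_of_mem n (subset_closure (by_contra fun h => hyH (subset_closure h))),
        abs_le] at *
      constructor <;> linarith [hy.1, hy.2]

lemma approx_fst_eq (n : ℕ) (p : P) (x : X) :
    B.approx n (B.fst p) x = min 1 (2 * B.approx (n + 1) p x) ∧
      B.approx n (B.snd p) x = max 0 (2 * B.approx (n + 1) p x - 1) := by
  have h1 := B.approx_mem_Icc n (B.fst p) x
  have h2 := B.approx_mem_Icc n (B.snd p) x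
  rw [approx_succ]
  by_cases hx : x ∈ B.half p
  · rw [B.approx_snd_of_mem _ (subset_closure hx), min_eq_right (by linarith [h1.2]),
      max_eq_left (by linarith [h1.2])]
    exact ⟨by ring, rfl⟩
  · rw [B.approx_fst_of_mem _ (subset_closure hx), min_eq_left (by linarith [h2.1]),
      max_eq_right (by linarith [h2.1])]
    exact ⟨rfl, by ring⟩

lemma isMedianPreserving_approx (M : MedianStruct X) (hH : ∀ p, M.IsHalfspace (B.half p))
    (n : ℕ) (p : P) : IsMedianPreserving M (B.approx n p) := by
  classical
  induction n generalizing p with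
  | zero =>
    intro x y z
    have h := (hH p).isBoolHom x y z
    by_cases hx : x ∈ B.half p <;> by_cases hy : y ∈ B.half p <;> by_cases hz : z ∈ B.half p <;>
      simp [hx, hy, hz, boolMed] at h <;> simp [approx, hx, hy, hz, h, realMed]
  | succ n ih =>
    intro x y z
    have hmono1 : Monotone fun t : ℝ => min 1 (2 * t) := fun a b h =>
      min_le_min le_rfl (by linarith)
    have hmono2 : Monotone fun t : ℝ => max 0 (2 * t - 1) := fun a b h =>
      max_le_max le_rfl (by linarith)
    rw [approx_succ, ih, ih, (B.approx_fst_eq n p x).1, (B.approx_fst_eq n p y).1,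
      (B.approx_fst_eq n p z).1, (B.approx_fst_eq n p x).2, (B.approx_fst_eq n p y).2,
      (B.approx_fst_eq n p z).2, ← hmono1.map_realMed, ← hmono2.map_realMed]
    generalize realMed _ _ _ = t
    rcases le_total (2 * t) 1 with h | h
    · rw [min_eq_right h, max_eq_left (by linarith)]
      ring
    · rw [min_eq_left h, max_eq_right (by linarith)]
      ring

theorem exists_continuous_isMedianPreserving (M : MedianStruct X)
    (hH : ∀ p, M.IsHalfspace (B.half p)) (p : P) :
    ∃ f ∈ MCfam M, (∀ x ∈ B.left p, f x = 0) ∧ ∀ x ∈ B.right p, f x = 1 := by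
  have hlim : ∀ x, ∃ t, Tendsto (fun n => B.approx n p x) atTop (𝓝 t) := fun x =>
    cauchySeq_tendsto_of_complete (cauchySeq_of_le_geometric_two (B.dist_approx_succ · p x))
  choose f hf using hlim
  have hdist : ∀ n x, |B.approx n p x - f x| ≤ 1 / 2 ^ n := fun n x =>
    dist_le_of_le_geometric_two_of_tendsto (B.dist_approx_succ · p x) (hf x) n
  refine ⟨f, ⟨continuous_iff_continuousAt.2 fun x => ?_, fun x y z => ?_, fun x =>
    isClosed_Icc.mem_of_tendsto (hf x) (Eventually.of_forall fun n => B.approx_mem_Icc n p x)⟩,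
    fun x hx => ?_, fun x hx => ?_⟩
  · rw [ContinuousAt, Metric.tendsto_nhds]
    intro ε hε
    obtain ⟨n, hn⟩ := exists_pow_lt_of_lt_one (show 0 < ε / 3 by positivity)
      (show (1 / 2 : ℝ) < 1 by norm_num)
    rw [one_div_pow] at hn
    filter_upwards [B.eventually_abs_approx_sub_le n p x] with y hy
    have h1 := abs_le.1 (hdist n x)
    have h2 := abs_le.1 (hdist n y)
    rw [abs_le] at hy
    rw [Real.dist_eq, abs_lt]
    constructor <;> linarith [h1.1, h1.2, h2.1, h2.2, hy.1, hy.2]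
  · refine tendsto_nhds_unique (hf (M.med x y z)) ?_
    simp only [B.isMedianPreserving_approx M hH _ p x y z]
    exact (((hf x).min (hf y)).max ((hf y).min (hf z))).max ((hf x).min (hf z))
  · exact tendsto_nhds_unique (hf x) (by simp [B.approx_of_mem_left _ hx])
  · exact tendsto_nhds_unique (hf x) (by simp [B.approx_of_mem_right _ hx])

end BisectionSystem

namespace MedianStruct

variable {X : Type*} {M : MedianStruct X} [TopologicalSpace X] [T2Space X] [CompactSpace X]

/-- Distinct points of a compact median algebra of finite rank are separated by a continuous
median-preserving function. -/
theorem exists_mem_MCfam (hm : Continuous fun p : X × X × X => M.med p.1 p.2.1 p.2.2)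
    (hrank : medRank M < ⊤) {x y : X} (hxy : x ≠ y) : ∃ f ∈ MCfam M, f x = 0 ∧ f y = 1 := by
  obtain ⟨n, hn⟩ := ENat.ne_top_iff_exists.1 hrank.ne
  let IsGood : Set X → Prop := fun A => IsClosed A ∧ M.IsConvex A ∧ A.Nonempty
  let P := {p : Set X × Set X // IsGood p.1 ∧ IsGood p.2 ∧ Disjoint p.1 p.2}
  have hgood : ∀ {C : Set X}, M.IsConvex C → C.Nonempty → IsGood (closure C) := fun hC hne =>
    ⟨isClosed_closure, isConvex_closure hm hC, hne.closure⟩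
  have hex : ∀ p : P, ∃ H, M.IsHalfspace H ∧ p.1.1 ⊆ interior H ∧ p.1.2 ⊆ interior Hᶜ :=
    fun p => exists_isHalfspace_interior hm hn.ge p.2.1.1 p.2.1.2.1 p.2.1.2.2
      p.2.2.1.1 p.2.2.1.2.1 p.2.2.1.2.2 p.2.2.2
  choose H hH hleft hright using hex
  let B : BisectionSystem X P :=
    { left := fun p => p.1.1
      right := fun p => p.1.2
      half := H
      fst := fun p => ⟨(p.1.1, closure (H p)ᶜ), p.2.1,
        hgood (hH p).2 (p.2.2.1.2.2.mono ((hright p).trans interior_subset)), by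
          rw [closure_compl]
          exact disjoint_compl_right.mono_left (hleft p)⟩
      snd := fun p => ⟨(closure (H p), p.1.2),
        hgood (hH p).1 (p.2.1.2.2.mono ((hleft p).trans interior_subset)), p.2.2.1, by
          have h := hright p
          rw [interior_compl] at h
          exact disjoint_compl_right.mono_right h⟩
      left_fst := fun _ => rfl
      right_fst := fun _ => rfl
      left_snd := fun _ => rfl
      right_snd := fun _ => rfl
      left_subset := fun p => (hleft p).trans interior_subset
      right_subset := fun p => (hright p).trans interior_subset }
  have hpt : ∀ z : X, IsGood {z} := fun z =>
    ⟨isClosed_singleton, isConvex_singleton z, singleton_nonempty z⟩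
  obtain ⟨f, hf, h0, h1⟩ := B.exists_continuous_isMedianPreserving M hH
    ⟨({x}, {y}), hpt x, hpt y, by simpa using hxy⟩
  exact ⟨f, hf, h0 x rfl, h1 y rfl⟩

end MedianStruct

lemma IsMedianPreserving.isConvex_le {X : Type*} {M : MedianStruct X} {f : X → ℝ}
    (hf : IsMedianPreserving M f) (a : ℝ) : M.IsConvex {x | f x ≤ a} := by
  intro x hx y hy z hz
  have hx : f x ≤ a := hx
  have hy : f y ≤ a := hy
  have h := hf x y z
  rw [show M.med x y z = z from hz] at h
  change f z ≤ a
  rw [h, realMed]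
  simp [hx, hy]

lemma IsMedianPreserving.isConvex_ge {X : Type*} {M : MedianStruct X} {f : X → ℝ}
    (hf : IsMedianPreserving M f) (b : ℝ) : M.IsConvex {x | b ≤ f x} := by
  intro x hx y hy z hz
  have hx : b ≤ f x := hx
  have hy : b ≤ f y := hy
  have h := hf x y z
  rw [show M.med x y z = z from hz] at h
  change b ≤ f z
  rw [h, realMed]
  simp [hx, hy]

/-- An independent sequence of median-preserving functions yields a cube. -/
theorem IndepFunFin.le_medRank {X : Type*} {M : MedianStruct X} {k : ℕ} {f : Fin k → X → ℝ}
    (hf : ∀ i, IsMedianPreserving M (f i)) (hind : IndepFunFin f) : (k : ℕ∞) ≤ medRank M := by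
  obtain ⟨a, b, hab, h⟩ := hind
  refine MedianStruct.le_medRank_of_corners
    (fun i c => if c then {x | b ≤ f i x} else {x | f i x ≤ a}) (fun i c => ?_) (fun i => ?_)
    fun ε => ?_
  · cases c
    · simpa using (hf i).isConvex_le a
    · simpa using (hf i).isConvex_ge b
  · simp only [if_true, Bool.false_eq_true, if_false]
    exact Set.disjoint_left.2 fun x (h1 : b ≤ f i x) (h2 : f i x ≤ a) => by linarith
  · obtain ⟨x, hx1, hx2⟩ := h (Finset.univ.filter (ε · = false)) (Finset.univ.filter (ε · = true))
      (Finset.disjoint_filter.2 fun i _ h => by simp [h])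
    refine ⟨x, fun i => ?_⟩
    simp only [Finset.mem_filter, Finset.mem_univ, true_and, mem_iInter] at hx1 hx2
    cases hε : ε i
    · simpa using hx1 i hε
    · simpa using hx2 i hε

/-- A cube yields independent coordinate functions as soon as points can be separated. -/
theorem exists_indepFunFin_of_cube {X : Type*} [TopologicalSpace X] {M : MedianStruct X}
    (hsep : ∀ x y : X, x ≠ y → ∃ f ∈ MCfam M, f x = 0 ∧ f y = 1) {n : ℕ}
    {c : (Fin n → Bool) → X} (hinj : Function.Injective c)
    (hc : IsMedianHom (boolCubeMed (Fin n)) M c) :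
    ∃ f : Fin n → X → ℝ, (∀ i, f i ∈ MCfam M) ∧ IndepFunFin f := by
  classical
  let o : Fin n → Bool := fun _ => false
  have hne : ∀ i, c o ≠ c (Function.update o i true) := fun i h => by
    simpa [o] using congrFun (hinj h) i
  choose f hf h0 h1 using fun i => hsep _ _ (hne i)
  have hval : ∀ i v, f i (c v) ≤ 0 ∧ v i = false ∨ 1 ≤ f i (c v) ∧ v i = true := by
    intro i v
    have hmed := hc o (Function.update o i true) v
    have hcube : (boolCubeMed (Fin n)).med o (Function.update o i true) v =
        if v i then Function.update o i true else o := by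
      funext j
      by_cases hj : j = i
      · subst hj
        cases hv : v j <;> simp [boolCubeMed, boolMed, o, hv]
      · cases hv : v i <;> simp [boolCubeMed, boolMed, o, hj]
    have h := congrArg (f i) hmed
    rw [(hf i).2.1, h0, h1, hcube] at h
    cases hv : v i
    · left
      simp only [hv, Bool.false_eq_true, if_false, h0, realMed] at h
      refine ⟨?_, rfl⟩
      by_contra! hpos
      have : 0 < min 1 (f i (c v)) := lt_min one_pos hpos
      have := (le_max_right (min (0 : ℝ) 1) (min 1 (f i (c v)))).trans
        (le_max_left _ (min 0 (f i (c v))))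
      linarith
    · right
      simp only [hv, if_true, h1, realMed] at h
      refine ⟨?_, rfl⟩
      by_contra! hlt
      have : max (max (min (0 : ℝ) 1) (min 1 (f i (c v)))) (min 0 (f i (c v))) < 1 :=
        max_lt (max_lt (by norm_num) ((min_le_right _ _).trans_lt hlt))
          ((min_le_left _ _).trans_lt one_pos)
      linarith
  refine ⟨f, hf, 0, 1, one_pos, fun S T hST => ⟨c fun i => decide (i ∈ T), ?_, ?_⟩⟩
  · simp only [mem_iInter]
    intro i hi
    rcases hval i fun i => decide (i ∈ T) with h | h
    · exact h.1
    · exact absurd (of_decide_eq_true h.2) (Finset.disjoint_left.1 hST hi)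
  · simp only [mem_iInter]
    intro i hi
    rcases hval i fun i => decide (i ∈ T) with h | h
    · exact absurd hi (of_decide_eq_false h.2)
    · exact h.1

lemma IndepFunSeq.indepFunFin {X : Type*} {F : ℕ → X → ℝ} (hF : IndepFunSeq F) (k : ℕ) :
    IndepFunFin fun i : Fin k => F i := by
  obtain ⟨a, b, hab, h⟩ := hF
  refine ⟨a, b, hab, fun S T hST => ?_⟩
  simpa using h (S.map Fin.valEmbedding) (T.map Fin.valEmbedding)
    ((Finset.disjoint_map _).2 hST)

/-- for a compact Hausdorff topological median algebra of finite
rank with a group `G` acting by median-preserving homeomorphisms, the family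
`𝓜𝓒` of continuous median-preserving maps `X → [0,1]` is `G`-invariant,
separates points, and has `ind(𝓜𝓒) = rank X < ∞`; in particular it contains no
infinite independent sequence (it is tame). -/
theorem MC_invariant_separating_tame {X : Type*} [TopologicalSpace X]
    [T2Space X] [CompactSpace X] (M : MedianStruct X)
    (hm : Continuous fun p : X × X × X => M.med p.1 p.2.1 p.2.2)
    (hrank : medRank M < ⊤)
    {G : Type*} [Group G] [MulAction G X]
    (hcont : ∀ g : G, Continuous fun x : X => g • x)
    (hmed : ∀ (g : G) (x y z : X), g • M.med x y z = M.med (g • x) (g • y) (g • z)) :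
    (∀ f ∈ MCfam M, ∀ g : G, (fun x => f (g • x)) ∈ MCfam M) ∧
    (∀ x y : X, x ≠ y → ∃ f ∈ MCfam M, f x ≠ f y) ∧
    (indFun (MCfam M) = medRank M ∧
      ¬ ∃ F : ℕ → X → ℝ, (∀ n, F n ∈ MCfam M) ∧ IndepFunSeq F) := by
  have hsep : ∀ x y : X, x ≠ y → ∃ f ∈ MCfam M, f x = 0 ∧ f y = 1 := fun x y hxy =>
    MedianStruct.exists_mem_MCfam hm hrank hxy
  refine ⟨fun f hf g => ⟨hf.1.comp (hcont g), fun x y z => ?_, fun x => hf.2.2 _⟩,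
    fun x y hxy => ?_, le_antisymm ?_ ?_, ?_⟩
  · simp only [hmed, hf.2.1 _ _ _]
  · obtain ⟨f, hf, h0, h1⟩ := hsep x y hxy
    exact ⟨f, hf, by rw [h0, h1]; exact zero_ne_one⟩
  · refine iSup₂_le fun k hk => ?_
    obtain ⟨f, hf, hind⟩ := hk
    exact hind.le_medRank fun i => (hf i).2.1
  · refine iSup₂_le fun n hn => ?_
    obtain ⟨c, hinj, hc⟩ := hn
    exact le_iSup₂_of_le n (exists_indepFunFin_of_cube hsep hinj hc) le_rfl
  · rintro ⟨F, hF, hind⟩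
    obtain ⟨n, hn⟩ := ENat.ne_top_iff_exists.1 hrank.ne
    have h := (hind.indepFunFin (n + 1)).le_medRank fun i => (hF i).2.1
    rw [← hn, Nat.cast_le] at h
    omega
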